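/- There is no solution (f, α, β, A) with f, α, β smooth real functions on (a connected open subset of) ℝ³ ∋ (x₁,x₂,x₃) with x₂ > 0 and A a real constant, to the system: (i) 2A − 1 − 2β + x₂∂₁α + x₂∂₁f = 0; (ii) A − 3/2 + x₂∂₂β = 0; (iii) A + 1/2 + ∂₃f = 0; (iv) 2α/x₂ + ∂₂α + ∂₁β + ∂₂f = 0; (v) 2(A + 1/2) − β + ∂₃α + ∂₃f + x₂∂₁f = 0; (vi) α + ∂₃β + x₂∂₂f = 0. Consequently, the geometry SL₂(ℝ)~ with metric g = (dx₁² + dx₂²)/x₂² + (dx₁/x₂ + dx₃)² admits no Ricci soliton structure. -/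

import Mathlib

open scoped BigOperators

noncomputable section

/-- Partial derivative of `f` in the `i`-th coordinate direction. -/
def pd {n : ℕ} (f : (Fin n → ℝ) → ℝ) (i : Fin n) (x : Fin n → ℝ) : ℝ :=
  fderiv ℝ f x (Pi.single i 1)

/-- Pointwise inverse of a metric (the components `g^{ij}`). -/
def ginv {n : ℕ} (g : (Fin n → ℝ) → Matrix (Fin n) (Fin n) ℝ) (x : Fin n → ℝ) :
    Matrix (Fin n) (Fin n) ℝ := (g x)⁻¹

/-- Christoffel symbols `Γ^k_{ij}` of the metric `g`. -/
def christoffel {n : ℕ} (g : (Fin n → ℝ) → Matrix (Fin n) (Fin n) ℝ)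
    (k i j : Fin n) (x : Fin n → ℝ) : ℝ :=
  (1 / 2) * ∑ l, ginv g x k l *
    (pd (fun y => g y l j) i x + pd (fun y => g y l i) j x - pd (fun y => g y i j) l x)

/-- The Ricci tensor in coordinates:
`Ric_{ij} = ∂_k Γ^k_{ij} − ∂_i Γ^k_{kj} + Γ^k_{kl} Γ^l_{ij} − Γ^k_{il} Γ^l_{kj}`. -/
def ricci {n : ℕ} (g : (Fin n → ℝ) → Matrix (Fin n) (Fin n) ℝ)
    (i j : Fin n) (x : Fin n → ℝ) : ℝ :=
  (∑ k, pd (christoffel g k i j) k x) - (∑ k, pd (christoffel g k k j) i x)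
    + (∑ k, ∑ l, christoffel g k k l x * christoffel g l i j x)
    - ∑ k, ∑ l, christoffel g k i l x * christoffel g l k j x

/-- Lie derivative of the metric:
`(L_E g)_{ij} = E^k ∂_k g_{ij} + g_{kj} ∂_i E^k + g_{ik} ∂_j E^k`. -/
def lieD {n : ℕ} (g : (Fin n → ℝ) → Matrix (Fin n) (Fin n) ℝ)
    (E : (Fin n → ℝ) → Fin n → ℝ) (i j : Fin n) (x : Fin n → ℝ) : ℝ :=
  (∑ k, E x k * pd (fun y => g y i j) k x)
    + (∑ k, g x k j * pd (fun y => E y k) i x)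
    + ∑ k, g x i k * pd (fun y => E y k) j x

/-- The dual 1-form `E♭ = g(E,·)`. -/
def flat {n : ℕ} (g : (Fin n → ℝ) → Matrix (Fin n) (Fin n) ℝ)
    (E : (Fin n → ℝ) → Fin n → ℝ) (j : Fin n) (x : Fin n → ℝ) : ℝ :=
  ∑ k, g x j k * E x k

/-- Partial derivative within a set. -/
def pdW {n : ℕ} (f : (Fin n → ℝ) → ℝ) (S : Set (Fin n → ℝ)) (i : Fin n)
    (x : Fin n → ℝ) : ℝ :=
  fderivWithin ℝ f S x (Pi.single i 1)

/-- The metric of `SL₂(ℝ)~`: `g = (dx₁² + dx₂²)/x₂² + (dx₁/x₂ + dx₃)²` on `{x₂ > 0}`. -/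
def sl2Metric (x : Fin 3 → ℝ) : Matrix (Fin 3) (Fin 3) ℝ :=
  Matrix.of fun i j =>
    !![2 / (x 1) ^ 2, 0, 1 / x 1;
       0, 1 / (x 1) ^ 2, 0;
       1 / x 1, 0, 1] i j

/-- The half-space `{x₂ > 0}` on which `SL₂(ℝ)~` is modelled. -/
def sl2Domain : Set (Fin 3 → ℝ) := {x | 0 < x 1}

/-- Lie derivative of the metric with derivatives of `E` taken within `S`. -/
def lieDW (g : (Fin 3 → ℝ) → Matrix (Fin 3) (Fin 3) ℝ)
    (E : (Fin 3 → ℝ) → Fin 3 → ℝ) (S : Set (Fin 3 → ℝ)) (i j : Fin 3)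
    (x : Fin 3 → ℝ) : ℝ :=
  (∑ k, E x k * pd (fun y => g y i j) k x)
    + (∑ k, g x k j * pdW (fun y => E y k) S i x)
    + ∑ k, g x i k * pdW (fun y => E y k) S j x

section PartialDerivatives

variable {n : ℕ} {V : Set (Fin n → ℝ)} {F G : (Fin n → ℝ) → ℝ} {i j : Fin n} {x : Fin n → ℝ}
  {a b : ℝ}

/-- `F` has partial derivative `a` at `x` in the `i`-th coordinate direction. -/
def HasPartial (F : (Fin n → ℝ) → ℝ) (i : Fin n) (x : Fin n → ℝ) (a : ℝ) : Prop :=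
  HasLineDerivAt ℝ F a x (Pi.single i 1)

theorem HasPartial.add (hF : HasPartial F i x a) (hG : HasPartial G i x b) :
    HasPartial (fun y => F y + G y) i x (a + b) :=
  HasDerivAt.add hF hG

theorem HasPartial.mul (hF : HasPartial F i x a) (hG : HasPartial G i x b) :
    HasPartial (fun y => F y * G y) i x (a * G x + F x * b) := by
  have h := HasDerivAt.mul hF hG
  simp only [zero_smul, add_zero] at h
  exact h

theorem HasPartial.const_mul (c : ℝ) (hF : HasPartial F i x a) :
    HasPartial (fun y => c * F y) i x (c * a) :=
  HasDerivAt.const_mul c hF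

theorem hasPartial_const (c : ℝ) : HasPartial (fun _ => c) i x 0 :=
  hasDerivAt_const _ _

theorem hasPartial_coord_self (i : Fin n) : HasPartial (fun y => y i) i x 1 := by
  simpa [HasPartial, HasLineDerivAt] using (hasDerivAt_id (0 : ℝ)).const_add (x i)

theorem hasPartial_coord_of_ne (h : j ≠ i) : HasPartial (fun y => y j) i x 0 := by
  simpa [HasPartial, HasLineDerivAt, h] using hasDerivAt_const (0 : ℝ) (x j)

theorem hasPartial_coord (i j : Fin n) :
    HasPartial (fun y => y j) i x (if i = j then 1 else 0) := by
  split_ifs with h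
  · subst h
    exact hasPartial_coord_self i
  · exact hasPartial_coord_of_ne (Ne.symm h)

theorem HasPartial.unique (hV : IsOpen V) (hx : x ∈ V) (h : Set.EqOn F G V)
    (hF : HasPartial F i x a) (hG : HasPartial G i x b) : a = b :=
  HasDerivAt.unique (hF : HasLineDerivAt ℝ F a x _)
    (HasLineDerivAt.congr_of_eventuallyEq hG (h.eventuallyEq_of_mem (hV.mem_nhds hx)))

theorem hasPartial_pdW (hV : IsOpen V) (hF : ContDiffOn ℝ (⊤ : ℕ∞) F V) (hx : x ∈ V) :
    HasPartial F i x (pdW F V i x) := by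
  have hd : DifferentiableAt ℝ F x :=
    (hF.differentiableOn (by simp)).differentiableAt (hV.mem_nhds hx)
  rw [pdW, fderivWithin_of_isOpen hV hx]
  exact hd.hasFDerivAt.hasLineDerivAt _

theorem pdW_eq_of_hasPartial (hV : IsOpen V) (hF : ContDiffOn ℝ (⊤ : ℕ∞) F V) (hx : x ∈ V)
    (h : HasPartial F i x a) : pdW F V i x = a :=
  (hasPartial_pdW hV hF hx).unique hV hx (fun _ _ => rfl) h

theorem contDiffOn_pdW (hV : IsOpen V) (hF : ContDiffOn ℝ (⊤ : ℕ∞) F V) (i : Fin n) :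
    ContDiffOn ℝ (⊤ : ℕ∞) (pdW F V i) V :=
  (hF.fderivWithin hV.uniqueDiffOn (by simp)).clm_apply contDiffOn_const

theorem pdW_congr (h : Set.EqOn F G V) (hx : x ∈ V) : pdW F V i x = pdW G V i x := by
  rw [pdW, pdW, fderivWithin_congr h (h hx)]

theorem pdW_comm (hV : IsOpen V) (hF : ContDiffOn ℝ (⊤ : ℕ∞) F V) (i j : Fin n) (hx : x ∈ V) :
    pdW (pdW F V i) V j x = pdW (pdW F V j) V i x := by
  have hs : IsSymmSndFDerivWithinAt ℝ F V x :=
    (hF x hx).isSymmSndFDerivWithinAt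
      (by rw [minSmoothness_of_isRCLikeNormedField]; exact WithTop.coe_le_coe.2 le_top)
      hV.uniqueDiffOn (subset_closure (hV.interior_eq.symm ▸ hx)) hx
  have hd : DifferentiableWithinAt ℝ (fderivWithin ℝ F V) V x :=
    (hF.fderivWithin (m := (⊤ : ℕ∞)) hV.uniqueDiffOn (by simp)).differentiableOn (by simp) x hx
  have key : ∀ k l : Fin n, pdW (pdW F V k) V l x =
      fderivWithin ℝ (fderivWithin ℝ F V) V x (Pi.single l 1) (Pi.single k 1) := by
    intro k l
    change fderivWithin ℝ (fun y => fderivWithin ℝ F V y (Pi.single k 1)) V x _ = _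
    rw [fderivWithin_clm_apply (hV.uniqueDiffOn x hx) hd (differentiableWithinAt_const _)]
    simp
  rw [key, key]
  exact hs _ _

end PartialDerivatives

theorem soliton_system_no_solution {V : Set (Fin 3 → ℝ)} (hV : IsOpen V) (hne : V.Nonempty)
    (hsub : V ⊆ sl2Domain) {f α β : (Fin 3 → ℝ) → ℝ} {A : ℝ}
    (hf : ContDiffOn ℝ (⊤ : ℕ∞) f V) (hα : ContDiffOn ℝ (⊤ : ℕ∞) α V)
    (hβ : ContDiffOn ℝ (⊤ : ℕ∞) β V)
    (e11 : ∀ x ∈ V, 2 * A - 1 - 2 * β x + x 1 * pdW α V 0 x + x 1 * pdW f V 0 x = 0)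
    (e22 : ∀ x ∈ V, A - 3 / 2 + x 1 * pdW β V 1 x = 0)
    (e33 : ∀ x ∈ V, A + 1 / 2 + pdW f V 2 x = 0)
    (e12 : ∀ x ∈ V, 2 * α x / x 1 + pdW α V 1 x + pdW β V 0 x + pdW f V 1 x = 0)
    (e13 : ∀ x ∈ V,
      2 * (A + 1 / 2) - β x + pdW α V 2 x + pdW f V 2 x + x 1 * pdW f V 0 x = 0)
    (e23 : ∀ x ∈ V, α x + pdW β V 2 x + x 1 * pdW f V 1 x = 0) : False := by
  have pos : ∀ x ∈ V, 0 < x 1 := hsub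
  have sm : ∀ {F} (i : Fin 3), ContDiffOn ℝ (⊤ : ℕ∞) F V →
    ContDiffOn ℝ (⊤ : ℕ∞) (pdW F V i) V := fun i h => contDiffOn_pdW hV h i
  have P : ∀ {F : (Fin 3 → ℝ) → ℝ} {i : Fin 3} {x}, ContDiffOn ℝ (⊤ : ℕ∞) F V → x ∈ V →
    HasPartial F i x (pdW F V i x) := fun h hx => hasPartial_pdW hV h hx
  have U : ∀ {F : (Fin 3 → ℝ) → ℝ} {i : Fin 3} {x : Fin 3 → ℝ} {a c : ℝ}, (∀ y ∈ V, F y = c) →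
    x ∈ V → HasPartial F i x a → a = 0 :=
    fun h hx hF => hF.unique hV hx h (hasPartial_const _)
  have y0 : ∀ {x : Fin 3 → ℝ}, HasPartial (fun y => y 1) 0 x 0 :=
    hasPartial_coord_of_ne (by decide)
  have y1 : ∀ {x : Fin 3 → ℝ}, HasPartial (fun y => y 1) 1 x 1 := hasPartial_coord_self 1
  have y2 : ∀ {x : Fin 3 → ℝ}, HasPartial (fun y => y 1) 2 x 0 :=
    hasPartial_coord_of_ne (by decide)
  have sf0 := sm 0 hf
  have sf1 := sm 1 hf
  have sf00 := sm 0 sf0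
  have sf11 := sm 1 sf1
  have sf01 := sm 1 sf0
  have sf000 := sm 0 sf00
  have f2 : ∀ i, ∀ x ∈ V, pdW (pdW f V 2) V i x = 0 := fun i x hx =>
    U (c := -(A + 1 / 2)) (fun y hy => by linarith [e33 y hy]) hx (P (sm 2 hf) hx)
  have f02 : ∀ x ∈ V, pdW (pdW f V 0) V 2 x = 0 := fun x hx => by
    rw [pdW_comm hV hf 0 2 hx, f2 0 x hx]
  have f12 : ∀ x ∈ V, pdW (pdW f V 1) V 2 x = 0 := fun x hx => by
    rw [pdW_comm hV hf 1 2 hx, f2 1 x hx]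
  have f002 : ∀ x ∈ V, pdW (pdW (pdW f V 0) V 0) V 2 x = 0 := fun x hx => by
    rw [pdW_comm hV sf0 0 2 hx]
    exact U f02 hx (P (sm 2 sf0) hx)
  have f112 : ∀ x ∈ V, pdW (pdW (pdW f V 1) V 1) V 2 x = 0 := fun x hx => by
    rw [pdW_comm hV sf1 1 2 hx]
    exact U f12 hx (P (sm 2 sf1) hx)
  have β21 : ∀ x ∈ V, pdW (pdW β V 2) V 1 x = 0 := fun x hx => by
    have h := U (c := -(A - 3 / 2)) (fun y hy => by linarith [e22 y hy]) hx
      (y2.mul (P (i := 2) (sm 1 hβ) hx))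
    rw [pdW_comm hV hβ 2 1 hx]
    have := pos x hx
    rcases mul_eq_zero.1 (by linarith : x 1 * pdW (pdW β V 1) V 2 x = 0) with h | h
    · linarith
    · exact h
  have α1 : ∀ x ∈ V,
      pdW α V 1 x + (pdW f V 1 x + x 1 * pdW (pdW f V 1) V 1 x) = 0 := fun x hx => by
    have h := U e23 hx (((P (i := 1) hα hx).add (P (sm 2 hβ) hx)).add (y1.mul (P sf1 hx)))
    linarith [β21 x hx]
  have e112 : ∀ x ∈ V, x 1 * pdW (pdW α V 2) V 0 x = 2 * pdW β V 2 x := fun x hx => by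
    have h := U (c := 1 - 2 * A) (fun y hy => by linarith [e11 y hy]) hx
      ((((P (i := 2) hβ hx).const_mul (-2)).add (y2.mul (P (sm 0 hα) hx))).add
        (y2.mul (P sf0 hx)))
    rw [f02 x hx, pdW_comm hV hα 0 2 hx] at h
    linarith
  have e13' : ∀ y ∈ V, -1 * β y + pdW α V 2 y + y 1 * pdW f V 0 y = -(A + 1 / 2) :=
    fun y hy => by linarith [e13 y hy, e33 y hy]
  have β0 : ∀ x ∈ V, x 1 * pdW β V 0 x + -2 * pdW β V 2 x
      + -1 * (x 1 * (x 1 * pdW (pdW f V 0) V 0 x)) = 0 := fun x hx => by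
    have h := U e13' hx
      ((((P (i := 0) hβ hx).const_mul (-1)).add (P (sm 2 hα) hx)).add (y0.mul (P sf0 hx)))
    linear_combination (-x 1) * h + e112 x hx
  have waveEq : ∀ x ∈ V, x 1 * pdW (pdW f V 0) V 0 x + -2 * pdW f V 1 x
      + -1 * (x 1 * pdW (pdW f V 1) V 1 x) = 0 := fun x hx => by
    have hy := (pos x hx).ne'
    have h := e12 x hx
    field_simp at h
    refine mul_left_cancel₀ hy ?_
    linear_combination h - x 1 * α1 x hx - β0 x hx - 2 * e23 x hx
  have β22 : ∀ x ∈ V, pdW (pdW β V 2) V 2 x = -pdW α V 2 x := fun x hx => by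
    have h := U e23 hx (((P (i := 2) hα hx).add (P (sm 2 hβ) hx)).add (y2.mul (P sf1 hx)))
    rw [f12 x hx] at h
    linarith
  have f01 : ∀ x ∈ V,
      x 1 * (x 1 * pdW (pdW f V 0) V 1 x) + x 1 * pdW f V 0 x = -2 := fun x hx => by
    have h1 := U β0 hx (((y2.mul (P (i := 2) (sm 0 hβ) hx)).add
      ((P (sm 2 hβ) hx).const_mul (-2))).add ((y2.mul (y2.mul (P sf00 hx))).const_mul (-1)))
    have h2 := U e23 hx (((P (i := 0) hα hx).add (P (sm 2 hβ) hx)).add (y0.mul (P sf1 hx)))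
    rw [f002 x hx, pdW_comm hV hβ 0 2 hx, β22 x hx] at h1
    rw [pdW_comm hV hf 1 0 hx] at h2
    linear_combination x 1 * h2 - h1 - e11 x hx + 2 * e13' x hx
  have f010 : ∀ x ∈ V, x 1 * pdW (pdW (pdW f V 0) V 1) V 0 x + pdW (pdW f V 0) V 0 x = 0 :=
    fun x hx => by
      have h := U f01 hx ((y0.mul (y0.mul (P sf01 hx))).add (y0.mul (P sf0 hx)))
      refine mul_left_cancel₀ (pos x hx).ne' ?_
      linear_combination h
  have f000 : ∀ x ∈ V, x 1 * (x 1 * (x 1 * pdW (pdW (pdW f V 0) V 0) V 0 x)) = 2 :=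
    fun x hx => by
      have h0 := U waveEq hx (((y0.mul (P sf00 hx)).add ((P sf1 hx).const_mul (-2))).add
        ((y0.mul (P sf11 hx)).const_mul (-1)))
      have h1 := U f01 hx ((y1.mul (y1.mul (P sf01 hx))).add (y1.mul (P sf0 hx)))
      have c : pdW (pdW (pdW f V 1) V 1) V 0 x = pdW (pdW (pdW f V 0) V 1) V 1 x := by
        rw [pdW_comm hV sf1 1 0 hx]
        exact pdW_congr (fun y hy => pdW_comm hV hf 1 0 hy) hx
      rw [c, pdW_comm hV hf 1 0 hx] at h0
      linear_combination x 1 ^ 2 * h0 + x 1 * h1 - f01 x hx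
  obtain ⟨x, hx⟩ := hne
  have hy := (pos x hx).ne'
  have h0 := U f010 hx ((y0.mul (P (sm 0 sf01) hx)).add (P sf00 hx))
  have h1 := U f000 hx (y1.mul (y1.mul (y1.mul (P sf000 hx))))
  have c : pdW (pdW (pdW (pdW f V 0) V 0) V 0) V 1 x
      = pdW (pdW (pdW (pdW f V 0) V 1) V 0) V 0 x := by
    rw [pdW_comm hV sf00 0 1 hx]
    exact pdW_congr (fun y hy => pdW_comm hV sf0 0 1 hy) hx
  rw [c] at h1
  have h2 := f000 x hx
  have : (4 : ℝ) = 0 := by linear_combination x 1 * h1 - x 1 ^ 3 * h0 - 2 * h2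
  norm_num at this

theorem fin_three_cases (i : Fin 3) : i = 0 ∨ i = 1 ∨ i = 2 := by
  omega

theorem pd_comp_coord {φ : ℝ → ℝ} {d : ℝ} {x : Fin 3 → ℝ} (h : HasDerivAt φ d (x 1)) (i : Fin 3) :
    pd (fun y => φ (y 1)) i x = if i = 1 then d else 0 := by
  have hp : HasFDerivAt (fun y : Fin 3 → ℝ => y 1) (ContinuousLinearMap.proj 1) x :=
    (ContinuousLinearMap.proj (R := ℝ) (φ := fun _ : Fin 3 => ℝ) 1).hasFDerivAt
  have hc : HasFDerivAt (fun y : Fin 3 → ℝ => φ (y 1)) _ x := h.comp_hasFDerivAt x hp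
  rw [pd, hc.fderiv]
  simp [Pi.single_apply, eq_comm]

theorem isOpen_sl2Domain : IsOpen sl2Domain :=
  isOpen_lt continuous_const (continuous_apply 1)

theorem isConnected_sl2Domain : IsConnected sl2Domain := by
  refine ⟨⟨fun _ => 1, one_pos (α := ℝ)⟩, Convex.isPreconnected ?_⟩
  exact convex_halfSpace_gt (LinearMap.proj (R := ℝ) (φ := fun _ : Fin 3 => ℝ) 1).isLinear 0

theorem pd_sl2Metric {x : Fin 3 → ℝ} (hx : x ∈ sl2Domain) (i j k : Fin 3) :
    pd (fun y => sl2Metric y i j) k x = if k = 1 then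
      !![-4 / x 1 ^ 3, 0, -1 / x 1 ^ 2; 0, -2 / x 1 ^ 3, 0; -1 / x 1 ^ 2, 0, 0] i j else 0 := by
  have hy : x 1 ≠ 0 := ne_of_gt hx
  have hinv : HasDerivAt (fun t : ℝ => 1 / t) (-1 / x 1 ^ 2) (x 1) := by
    simpa [neg_div] using hasDerivAt_inv hy
  have hsq : ∀ c : ℝ, HasDerivAt (fun t : ℝ => c / t ^ 2) (-2 * c / x 1 ^ 3) (x 1) := fun c => by
    refine ((hasDerivAt_const (x 1) c).div (hasDerivAt_pow 2 (x 1))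
      (pow_ne_zero 2 hy)).congr_deriv ?_
    field_simp
    ring
  have h2 : HasDerivAt (fun t : ℝ => 2 / t ^ 2) (-4 / x 1 ^ 3) (x 1) := by
    convert hsq 2 using 2
    norm_num
  have h1 : HasDerivAt (fun t : ℝ => 1 / t ^ 2) (-2 / x 1 ^ 3) (x 1) := by
    convert hsq 1 using 2
    norm_num
  rcases fin_three_cases i with rfl | rfl | rfl <;> rcases fin_three_cases j with rfl | rfl | rfl
  · exact pd_comp_coord h2 k
  · exact pd_comp_coord (hasDerivAt_const _ 0) k
  · exact pd_comp_coord hinv k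
  · exact pd_comp_coord (hasDerivAt_const _ 0) k
  · exact pd_comp_coord h1 k
  · exact pd_comp_coord (hasDerivAt_const _ 0) k
  · exact pd_comp_coord hinv k
  · exact pd_comp_coord (hasDerivAt_const _ 0) k
  · exact pd_comp_coord (hasDerivAt_const _ 1) k

theorem ginv_sl2Metric {x : Fin 3 → ℝ} (hx : x ∈ sl2Domain) :
    ginv sl2Metric x = !![x 1 ^ 2, 0, -x 1; 0, x 1 ^ 2, 0; -x 1, 0, 2] := by
  have hy : x 1 ≠ 0 := ne_of_gt hx
  refine Matrix.inv_eq_right_inv ?_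
  ext i j
  rcases fin_three_cases i with rfl | rfl | rfl <;> rcases fin_three_cases j with rfl | rfl | rfl <;>
    simp [sl2Metric, Matrix.mul_apply, Fin.sum_univ_three] <;> field_simp <;> norm_num

/-- Coefficients of the Christoffel symbols of `sl2Metric` that are constant in `x`. -/
def sl2ChristoffelZero : Fin 3 → Matrix (Fin 3) (Fin 3) ℝ
  | 0 => !![0, 0, 0; 0, 0, -1 / 2; 0, -1 / 2, 0]
  | 1 => !![0, 0, 1 / 2; 0, 0, 0; 1 / 2, 0, 0]
  | 2 => 0

/-- Coefficients of `x₂⁻¹` in the Christoffel symbols of `sl2Metric`. -/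
def sl2ChristoffelOne : Fin 3 → Matrix (Fin 3) (Fin 3) ℝ
  | 0 => !![0, -3 / 2, 0; -3 / 2, 0, 0; 0, 0, 0]
  | 1 => !![2, 0, 0; 0, -1, 0; 0, 0, 0]
  | 2 => !![0, 0, 0; 0, 0, 1 / 2; 0, 1 / 2, 0]

/-- Coefficients of `x₂⁻²` in the Christoffel symbols of `sl2Metric`. -/
def sl2ChristoffelTwo : Fin 3 → Matrix (Fin 3) (Fin 3) ℝ
  | 0 => 0
  | 1 => 0
  | 2 => !![0, 1, 0; 1, 0, 0; 0, 0, 0]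

theorem christoffel_sl2Metric {x : Fin 3 → ℝ} (hx : x ∈ sl2Domain) (k i j : Fin 3) :
    christoffel sl2Metric k i j x = sl2ChristoffelZero k i j + sl2ChristoffelOne k i j / x 1
      + sl2ChristoffelTwo k i j / x 1 ^ 2 := by
  have hy : x 1 ≠ 0 := ne_of_gt hx
  simp only [christoffel, ginv_sl2Metric hx, pd_sl2Metric hx, Fin.sum_univ_three]
  rcases fin_three_cases k with rfl | rfl | rfl <;> rcases fin_three_cases i with rfl | rfl | rfl <;>
    rcases fin_three_cases j with rfl | rfl | rfl <;>
    simp [sl2ChristoffelZero, sl2ChristoffelOne, sl2ChristoffelTwo] <;> field_simp <;> norm_num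

theorem pd_christoffel_sl2Metric {x : Fin 3 → ℝ} (hx : x ∈ sl2Domain) (k i j l : Fin 3) :
    pd (christoffel sl2Metric k i j) l x = if l = 1 then
      -sl2ChristoffelOne k i j / x 1 ^ 2 - 2 * sl2ChristoffelTwo k i j / x 1 ^ 3 else 0 := by
  have hy : x 1 ≠ 0 := ne_of_gt hx
  have hev : christoffel sl2Metric k i j =ᶠ[nhds x] fun y => sl2ChristoffelZero k i j
      + sl2ChristoffelOne k i j / y 1 + sl2ChristoffelTwo k i j / y 1 ^ 2 :=
    Filter.eventuallyEq_of_mem (isOpen_sl2Domain.mem_nhds hx)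
      fun y hy => christoffel_sl2Metric hy k i j
  have hd : HasDerivAt (fun t : ℝ => sl2ChristoffelZero k i j
      + sl2ChristoffelOne k i j / t + sl2ChristoffelTwo k i j / t ^ 2)
      (-sl2ChristoffelOne k i j / x 1 ^ 2 - 2 * sl2ChristoffelTwo k i j / x 1 ^ 3) (x 1) := by
    refine ((((hasDerivAt_const (x 1) (sl2ChristoffelOne k i j)).div
      (hasDerivAt_id (x 1)) hy).const_add (sl2ChristoffelZero k i j)).add
      ((hasDerivAt_const (x 1) (sl2ChristoffelTwo k i j)).div (hasDerivAt_pow 2 (x 1))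
        (pow_ne_zero 2 hy))).congr_deriv ?_
    simp only [id]
    field_simp
    ring
  rw [← pd_comp_coord hd l, pd, pd, hev.fderiv_eq]

theorem ricci_sl2Metric {x : Fin 3 → ℝ} (hx : x ∈ sl2Domain) (i j : Fin 3) :
    ricci sl2Metric i j x =
      !![-1 / x 1 ^ 2, 0, 1 / (2 * x 1); 0, -3 / (2 * x 1 ^ 2), 0;
        1 / (2 * x 1), 0, 1 / 2] i j := by
  have hy : x 1 ≠ 0 := ne_of_gt hx
  simp only [ricci, christoffel_sl2Metric hx, pd_christoffel_sl2Metric hx, Fin.sum_univ_three]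
  rcases fin_three_cases i with rfl | rfl | rfl <;> rcases fin_three_cases j with rfl | rfl | rfl <;>
    simp [sl2ChristoffelZero, sl2ChristoffelOne, sl2ChristoffelTwo] <;> field_simp <;> norm_num

theorem not_exists_sl2_soliton {E : (Fin 3 → ℝ) → Fin 3 → ℝ} {A : ℝ}
    (hE : ∀ k, ContDiffOn ℝ (⊤ : ℕ∞) (fun x => E x k) sl2Domain)
    (h : ∀ x ∈ sl2Domain, ∀ i j, -2 * ricci sl2Metric i j x =
      lieDW sl2Metric E sl2Domain i j x + 2 * A * sl2Metric x i j) : False := by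
  have hV := isOpen_sl2Domain
  have hne : ∀ x ∈ sl2Domain, x 1 ≠ 0 := fun x hx => ne_of_gt hx
  have hy : ContDiffOn ℝ (⊤ : ℕ∞) (fun x : Fin 3 → ℝ => x 1) sl2Domain :=
    (contDiff_apply ℝ ℝ 1).contDiffOn
  set α : (Fin 3 → ℝ) → ℝ := fun x => E x 0 / x 1 with hα
  set β : (Fin 3 → ℝ) → ℝ := fun x => E x 1 / x 1 with hβ
  set f : (Fin 3 → ℝ) → ℝ := fun x => E x 2 + α x with hf
  have sα : ContDiffOn ℝ (⊤ : ℕ∞) α sl2Domain := (hE 0).div hy hne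
  have sβ : ContDiffOn ℝ (⊤ : ℕ∞) β sl2Domain := (hE 1).div hy hne
  have sf : ContDiffOn ℝ (⊤ : ℕ∞) f sl2Domain := (hE 2).add sα
  have E0 : ∀ x ∈ sl2Domain, E x 0 = x 1 * α x := fun x hx => by
    rw [hα, mul_div_cancel₀ _ (hne x hx)]
  have E1 : ∀ x ∈ sl2Domain, E x 1 = x 1 * β x := fun x hx => by
    rw [hβ, mul_div_cancel₀ _ (hne x hx)]
  have pE0 : ∀ x ∈ sl2Domain, ∀ i, pdW (fun y => E y 0) sl2Domain i x
      = (if i = 1 then 1 else 0) * α x + x 1 * pdW α sl2Domain i x := fun x hx i =>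
    (hasPartial_pdW hV (hE 0) hx).unique hV hx E0
      ((hasPartial_coord i 1).mul (hasPartial_pdW hV sα hx))
  have pE1 : ∀ x ∈ sl2Domain, ∀ i, pdW (fun y => E y 1) sl2Domain i x
      = (if i = 1 then 1 else 0) * β x + x 1 * pdW β sl2Domain i x := fun x hx i =>
    (hasPartial_pdW hV (hE 1) hx).unique hV hx E1
      ((hasPartial_coord i 1).mul (hasPartial_pdW hV sβ hx))
  have pE2 : ∀ x ∈ sl2Domain, ∀ i, pdW (fun y => E y 2) sl2Domain i x
      = pdW f sl2Domain i x - pdW α sl2Domain i x := fun x hx i => by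
    rw [pdW_eq_of_hasPartial hV sf hx
      ((hasPartial_pdW hV (hE 2) hx).add (hasPartial_pdW hV sα hx)), add_sub_cancel_right]
  have key : ∀ x ∈ sl2Domain, ∀ i j, _ := fun x hx i j => by
    have hij := h x hx i j
    rw [ricci_sl2Metric hx, lieDW] at hij
    simp only [Fin.sum_univ_three, pd_sl2Metric hx, pE0 x hx, pE1 x hx, pE2 x hx, E0 x hx,
      E1 x hx] at hij
    exact hij
  refine soliton_system_no_solution (A := A) hV isConnected_sl2Domain.nonempty subset_rfl sf sα sβ
    ?_ ?_ ?_ ?_ ?_ ?_ <;> intro x hx <;> have hy := hne x hx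
  · have e := key x hx 0 0
    simp [sl2Metric] at e
    field_simp at e
    linarith
  · have e := key x hx 1 1
    simp [sl2Metric] at e
    field_simp at e
    linarith
  · have e := key x hx 2 2
    simp [sl2Metric] at e
    field_simp at e
    linarith
  · have e := key x hx 0 1
    simp [sl2Metric] at e
    field_simp at e ⊢
    linarith
  · have e := key x hx 0 2
    simp [sl2Metric] at e
    field_simp at e
    linarith
  · have e := key x hx 1 2
    simp [sl2Metric] at e
    field_simp at e
    linarith

/-- The component system of the soliton equation on `SL₂(ℝ)~` has no
solution `(f, α, β, A)` on any connected open subset of `{x₂ > 0}`; consequently the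
geometry `SL₂(ℝ)~` admits no Ricci soliton structure. -/
theorem sl2_admits_no_soliton :
    (∀ V : Set (Fin 3 → ℝ), IsOpen V → IsConnected V → V ⊆ sl2Domain →
      ¬ ∃ (f α β : (Fin 3 → ℝ) → ℝ) (A : ℝ),
        ContDiffOn ℝ (⊤ : ℕ∞) f V ∧ ContDiffOn ℝ (⊤ : ℕ∞) α V ∧
        ContDiffOn ℝ (⊤ : ℕ∞) β V ∧
        ∀ x ∈ V,
          (2 * A - 1 - 2 * β x + x 1 * pdW α V 0 x + x 1 * pdW f V 0 x = 0) ∧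
          (A - 3 / 2 + x 1 * pdW β V 1 x = 0) ∧
          (A + 1 / 2 + pdW f V 2 x = 0) ∧
          (2 * α x / x 1 + pdW α V 1 x + pdW β V 0 x + pdW f V 1 x = 0) ∧
          (2 * (A + 1 / 2) - β x + pdW α V 2 x + pdW f V 2 x + x 1 * pdW f V 0 x = 0) ∧
          (α x + pdW β V 2 x + x 1 * pdW f V 1 x = 0)) ∧
    ¬ ∃ (E : (Fin 3 → ℝ) → Fin 3 → ℝ) (A : ℝ),
        (∀ k, ContDiffOn ℝ (⊤ : ℕ∞) (fun x => E x k) sl2Domain) ∧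
        ∀ x ∈ sl2Domain, ∀ i j,
          -2 * ricci sl2Metric i j x =
            lieDW sl2Metric E sl2Domain i j x + 2 * A * sl2Metric x i j := by
  refine ⟨?_, ?_⟩
  · rintro V hV hc hsub ⟨f, α, β, A, hf, hα, hβ, h⟩
    exact soliton_system_no_solution hV hc.nonempty hsub hf hα hβ (fun x hx => (h x hx).1)
      (fun x hx => (h x hx).2.1) (fun x hx => (h x hx).2.2.1) (fun x hx => (h x hx).2.2.2.1)
      (fun x hx => (h x hx).2.2.2.2.1) (fun x hx => (h x hx).2.2.2.2.2)
  · rintro ⟨E, A, hE, h⟩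
    exact not_exists_sl2_soliton hE h
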